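/- arXiv:2508.19523 — 3 statements merged into one kernel-verified Lean document; each statement's English description precedes it below -/
import Mathlib

section
/- Let n ≥ 4 and x_1, …, x_n ∈ ℝ^p. Then, identically in x_1, …, x_n, the aggregated statistic M_n = Σ_{τ=2}^{n−2} (τ(n−τ)/n) M_n(τ) satisfies M_n = Σ_{k=2}^{n} Σ_{i=1}^{k−1} a_{i,k} · x_iᵀ x_k. -/
open Finset

/-- The mean-change two-sample U-statistic `M_n(τ)`. -/
noncomputable def Mstat (n p : ℕ) (x : ℕ → Fin p → ℝ) (τ : ℕ) : ℝ :=
  ((τ : ℝ) * ((τ : ℝ) - 1) * ((n : ℝ) - (τ : ℝ)) * ((n : ℝ) - (τ : ℝ) - 1))⁻¹ *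
    ∑ i1 ∈ Finset.Icc 1 τ, ∑ i2 ∈ Finset.Icc 1 τ,
      ∑ j1 ∈ Finset.Icc (τ + 1) n, ∑ j2 ∈ Finset.Icc (τ + 1) n,
        if i1 ≠ i2 ∧ j1 ≠ j2 then
          ∑ l, (x i1 l - x j1 l) * (x i2 l - x j2 l)
        else 0

/-- The coefficients `a_{i,k}` for `1 ≤ i < k ≤ n`:
`a_{i,k} = Σ_{τ=2}^{i−1} 2(1−1/n)/(n−τ−1) + Σ_{τ=k}^{n−2} 2(1−1/n)/(τ−1) + 6/n − 2`. -/
noncomputable def acoef (n i k : ℕ) : ℝ :=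
  (∑ τ ∈ Finset.Icc 2 (i - 1), 2 * (1 - 1 / (n : ℝ)) / ((n : ℝ) - (τ : ℝ) - 1))
  + (∑ τ ∈ Finset.Icc k (n - 2), 2 * (1 - 1 / (n : ℝ)) / ((τ : ℝ) - 1))
  + 6 / (n : ℝ) - 2

lemma sum_offDiag_mul_sub (A B : Finset ℕ) (f : ℕ → ℝ) :
    ∑ i1 ∈ A, ∑ i2 ∈ A, ∑ j1 ∈ B, ∑ j2 ∈ B,
        (if i1 ≠ i2 ∧ j1 ≠ j2 then (f i1 - f j1) * (f i2 - f j2) else 0)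
      = (#B : ℝ) * (#B - 1) * ((∑ i ∈ A, f i) ^ 2 - ∑ i ∈ A, f i ^ 2)
        + (#A : ℝ) * (#A - 1) * ((∑ j ∈ B, f j) ^ 2 - ∑ j ∈ B, f j ^ 2)
        - 2 * (#A - 1) * (#B - 1) * (∑ i ∈ A, f i) * ∑ j ∈ B, f j := by
  have inner (a b : ℝ) : ∑ j1 ∈ B, ∑ j2 ∈ B,
      (if j1 ≠ j2 then (a - f j1) * (b - f j2) else 0)
      = (#B : ℝ) * (#B - 1) * (a * b) - (#B - 1) * (a + b) * (∑ j ∈ B, f j)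
        + ((∑ j ∈ B, f j) ^ 2 - ∑ j ∈ B, f j ^ 2) := by
    have split (j1 j2 : ℕ) : (if j1 ≠ j2 then (a - f j1) * (b - f j2) else 0)
        = (a - f j1) * (b - f j2) - if j1 = j2 then (a - f j1) * (b - f j2) else 0 := by
      split_ifs <;> simp_all
    have diag (j : ℕ) : (a - f j) * (b - f j) = a * b - (a + b) * f j + f j ^ 2 := by ring
    simp only [split, sum_sub_distrib, ← mul_sum, ← sum_mul, sum_ite_eq, sum_const, nsmul_eq_mul]
    rw [sum_congr rfl fun j hj => if_pos hj]
    simp only [diag, sum_add_distrib, sum_sub_distrib, ← mul_sum, sum_const, nsmul_eq_mul]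
    ring
  have split (i1 i2 : ℕ) : ∑ j1 ∈ B, ∑ j2 ∈ B,
      (if i1 ≠ i2 ∧ j1 ≠ j2 then (f i1 - f j1) * (f i2 - f j2) else 0)
      = ((#B : ℝ) * (#B - 1) * (f i1 * f i2) - (#B - 1) * (f i1 + f i2) * (∑ j ∈ B, f j)
        + ((∑ j ∈ B, f j) ^ 2 - ∑ j ∈ B, f j ^ 2))
        - if i1 = i2 then ((#B : ℝ) * (#B - 1) * (f i1 * f i2)
          - (#B - 1) * (f i1 + f i2) * (∑ j ∈ B, f j)
          + ((∑ j ∈ B, f j) ^ 2 - ∑ j ∈ B, f j ^ 2)) else 0 := by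
    by_cases h : i1 = i2
    · simp [h]
    · simp only [ne_eq, h, not_false_eq_true, true_and, if_false, sub_zero]
      exact inner _ _
  simp only [split, sum_sub_distrib, sum_add_distrib, ← mul_sum, ← sum_mul, sum_ite_eq, sum_const,
    nsmul_eq_mul]
  rw [sum_congr rfl fun j hj => if_pos hj]
  simp only [← sq, sum_add_distrib, sum_sub_distrib, ← mul_sum, ← sum_mul, sum_const, nsmul_eq_mul]
  ring

lemma sum_mul_lt_pairs (n : ℕ) (g : ℕ → ℝ) :
    ∑ k ∈ Icc 2 n, ∑ i ∈ Icc 1 (k - 1), g i * g k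
      = ((∑ i ∈ Icc 1 n, g i) ^ 2 - ∑ i ∈ Icc 1 n, g i ^ 2) / 2 := by
  induction n with
  | zero => simp
  | succ m ih =>
    rcases Nat.eq_zero_or_pos m with rfl | hm
    · simp
    · rw [sum_Icc_succ_top (by omega), sum_Icc_succ_top (by omega), sum_Icc_succ_top (by omega), ih,
        Nat.add_sub_cancel, ← sum_mul]
      ring

/-- The contribution of the split point `τ` to the coefficient of `x_iᵀx_k`. -/
noncomputable def splitCoef (n τ i k : ℕ) : ℝ :=
  (if τ < i then 2 * (1 - 1 / (n : ℝ)) / ((n : ℝ) - (τ : ℝ) - 1) else 0)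
  + (if k ≤ τ then 2 * (1 - 1 / (n : ℝ)) / ((τ : ℝ) - 1) else 0) - 2 / (n : ℝ)

lemma sum_splitCoef {n i k : ℕ} (hn : 4 ≤ n) (hi : 1 ≤ i) (hik : i < k) (hk : k ≤ n) :
    ∑ τ ∈ Icc 2 (n - 2), splitCoef n τ i k = acoef n i k := by
  have h1 : (Icc 2 (n - 2)).filter (fun τ => τ < i) = Icc 2 (i - 1) := by
    ext τ; simp only [mem_filter, mem_Icc]; omega
  have h2 : (Icc 2 (n - 2)).filter (fun τ => k ≤ τ) = Icc k (n - 2) := by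
    ext τ; simp only [mem_filter, mem_Icc]; omega
  have hn0 : (n : ℝ) ≠ 0 := by positivity
  have hcard : ((n - 2 + 1 - 2 : ℕ) : ℝ) = n - 3 := by
    rw [show n - 2 + 1 - 2 = n - 3 by omega, Nat.cast_sub (by omega)]; norm_num
  simp only [splitCoef, acoef, sum_sub_distrib, sum_add_distrib, ← sum_filter, h1, h2, sum_const,
    nsmul_eq_mul, Nat.card_Icc, hcard]
  field_simp
  ring

lemma sum_mul_lt_pairs_le {n τ : ℕ} (hτ : τ ≤ n) (f : ℕ → ℝ) :
    ∑ k ∈ Icc 2 n, ∑ i ∈ Icc 1 (k - 1), (if k ≤ τ then f i * f k else 0)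
      = ((∑ i ∈ Icc 1 τ, f i) ^ 2 - ∑ i ∈ Icc 1 τ, f i ^ 2) / 2 := by
  have hfilter : (Icc 1 n).filter (fun i => i ≤ τ) = Icc 1 τ := by
    ext i; simp only [mem_filter, mem_Icc]; omega
  have h := sum_mul_lt_pairs n fun i => if i ≤ τ then f i else 0
  simp only [ite_pow, ne_eq, OfNat.ofNat_ne_zero, not_false_eq_true, zero_pow, ← sum_filter,
    hfilter] at h
  rw [← h]
  refine sum_congr rfl fun k _ => sum_congr rfl fun i hi => ?_
  rw [mem_Icc] at hi
  by_cases hk : k ≤ τ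
  · simp [hk, show i ≤ τ by omega]
  · simp [hk]

lemma sum_mul_lt_pairs_gt (n τ : ℕ) (f : ℕ → ℝ) :
    ∑ k ∈ Icc 2 n, ∑ i ∈ Icc 1 (k - 1), (if τ < i then f i * f k else 0)
      = ((∑ i ∈ Icc (τ + 1) n, f i) ^ 2 - ∑ i ∈ Icc (τ + 1) n, f i ^ 2) / 2 := by
  have hfilter : (Icc 1 n).filter (fun i => τ < i) = Icc (τ + 1) n := by
    ext i; simp only [mem_filter, mem_Icc]; omega
  have h := sum_mul_lt_pairs n fun i => if τ < i then f i else 0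
  simp only [ite_pow, ne_eq, OfNat.ofNat_ne_zero, not_false_eq_true, zero_pow, ← sum_filter,
    hfilter] at h
  rw [← h]
  refine sum_congr rfl fun k hk => sum_congr rfl fun i hi => ?_
  rw [mem_Icc] at hi hk
  by_cases hi' : τ < i
  · simp [hi', show τ < k by omega]
  · simp [hi']

lemma sum_splitCoef_mul {n τ : ℕ} (h2 : 2 ≤ τ) (hτ : τ + 2 ≤ n) (f : ℕ → ℝ) :
    ((τ : ℝ) * ((n : ℝ) - τ) / n) *
      (((τ : ℝ) * ((τ : ℝ) - 1) * ((n : ℝ) - (τ : ℝ)) * ((n : ℝ) - (τ : ℝ) - 1))⁻¹ *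
        ∑ i1 ∈ Icc 1 τ, ∑ i2 ∈ Icc 1 τ, ∑ j1 ∈ Icc (τ + 1) n, ∑ j2 ∈ Icc (τ + 1) n,
          (if i1 ≠ i2 ∧ j1 ≠ j2 then (f i1 - f j1) * (f i2 - f j2) else 0))
      = ∑ k ∈ Icc 2 n, ∑ i ∈ Icc 1 (k - 1), splitCoef n τ i k * (f i * f k) := by
  have hexpand (i k : ℕ) : splitCoef n τ i k * (f i * f k)
      = 2 * (1 - 1 / (n : ℝ)) / ((n : ℝ) - (τ : ℝ) - 1) * (if τ < i then f i * f k else 0)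
        + 2 * (1 - 1 / (n : ℝ)) / ((τ : ℝ) - 1) * (if k ≤ τ then f i * f k else 0)
        - 2 / (n : ℝ) * (f i * f k) := by
    unfold splitCoef
    split_ifs <;> ring
  have hsum (g : ℕ → ℝ) :
      ∑ i ∈ Icc 1 n, g i = ∑ i ∈ Icc 1 τ, g i + ∑ i ∈ Icc (τ + 1) n, g i := by
    rw [← sum_union (disjoint_left.2 fun i hi hj => by rw [mem_Icc] at hi hj; omega)]
    congr 1
    ext i; simp only [mem_union, mem_Icc]; omega
  have hcard : ((n + 1 - (τ + 1) : ℕ) : ℝ) = n - τ := by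
    rw [Nat.add_sub_add_right, Nat.cast_sub (by omega)]
  have h2' : (2 : ℝ) ≤ τ := by exact_mod_cast h2
  have hτ' : (τ : ℝ) + 2 ≤ n := by exact_mod_cast hτ
  have hn0 : (n : ℝ) ≠ 0 := by linarith
  have hτ0 : (τ : ℝ) ≠ 0 := by linarith
  have hτ1 : (τ : ℝ) - 1 ≠ 0 := by linarith
  have hm0 : (n : ℝ) - τ ≠ 0 := by linarith
  have hm1 : (n : ℝ) - τ - 1 ≠ 0 := by linarith
  simp only [hexpand, sum_sub_distrib, sum_add_distrib, ← mul_sum,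
    sum_mul_lt_pairs_le (show τ ≤ n by omega), sum_mul_lt_pairs_gt, sum_mul_lt_pairs, hsum,
    sum_offDiag_mul_sub, Nat.card_Icc, Nat.add_sub_cancel, hcard]
  field_simp
  ring

lemma Mstat_eq_sum_coord (n p : ℕ) (x : ℕ → Fin p → ℝ) (τ : ℕ) :
    Mstat n p x τ = ∑ l,
      ((τ : ℝ) * ((τ : ℝ) - 1) * ((n : ℝ) - (τ : ℝ)) * ((n : ℝ) - (τ : ℝ) - 1))⁻¹ *
        ∑ i1 ∈ Icc 1 τ, ∑ i2 ∈ Icc 1 τ, ∑ j1 ∈ Icc (τ + 1) n, ∑ j2 ∈ Icc (τ + 1) n,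
          (if i1 ≠ i2 ∧ j1 ≠ j2 then (x i1 l - x j1 l) * (x i2 l - x j2 l) else 0) := by
  rw [Mstat, ← mul_sum]
  congr 1
  symm
  refine sum_comm.trans <| sum_congr rfl fun i1 _ => sum_comm.trans <| sum_congr rfl fun i2 _ =>
    sum_comm.trans <| sum_congr rfl fun j1 _ => sum_comm.trans <| sum_congr rfl fun j2 _ => ?_
  split_ifs <;> simp

/-- `M_n = Σ_{τ=2}^{n−2} (τ(n−τ)/n) M_n(τ) = Σ_{k=2}^{n} Σ_{i=1}^{k−1} a_{i,k} x_iᵀx_k`. -/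
theorem stmt1 (n p : ℕ) (hn : 4 ≤ n) (x : ℕ → Fin p → ℝ) :
    ∑ τ ∈ Finset.Icc 2 (n - 2), ((τ : ℝ) * ((n : ℝ) - (τ : ℝ)) / (n : ℝ)) * Mstat n p x τ
      = ∑ k ∈ Finset.Icc 2 n, ∑ i ∈ Finset.Icc 1 (k - 1),
          acoef n i k * ∑ l, x i l * x k l := by
  have hsplit : ∀ τ ∈ Icc 2 (n - 2), ((τ : ℝ) * ((n : ℝ) - (τ : ℝ)) / (n : ℝ)) * Mstat n p x τ
      = ∑ k ∈ Icc 2 n, ∑ i ∈ Icc 1 (k - 1), splitCoef n τ i k * ∑ l, x i l * x k l := by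
    intro τ hτ
    rw [mem_Icc] at hτ
    rw [Mstat_eq_sum_coord, mul_sum, sum_congr rfl fun l _ =>
      sum_splitCoef_mul hτ.1 (by omega) fun i => x i l, sum_comm]
    refine sum_congr rfl fun k _ => ?_
    rw [sum_comm]
    exact sum_congr rfl fun i _ => (mul_sum _ _ _).symm
  rw [sum_congr rfl hsplit, sum_comm]
  refine sum_congr rfl fun k hk => ?_
  rw [sum_comm]
  refine sum_congr rfl fun i hi => ?_
  rw [mem_Icc] at hk hi
  rw [← sum_mul, sum_splitCoef hn hi.1 (by omega) hk.2]
end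

section
/- Let n ≥ 4 and let a_{i,k} be the coefficients defined below, extended symmetrically by a_{k,i} = a_{i,k} for i < k and a_{i,i} = 0. Then for every i ∈ {1, …, n}, the row sum vanishes: Σ_{j=1}^{n} a_{i,j} = 0. -/
open Finset

/-- The symmetric extension: `a_{k,i} = a_{i,k}` for `i < k` and `a_{i,i} = 0`. -/
noncomputable def asym (n i j : ℕ) : ℝ :=
  if i = j then 0 else if i < j then acoef n i j else acoef n j i

/-- The sum of `1 / (n - τ - 1)` over `2 ≤ τ ≤ i - 1`. -/
noncomputable def lowerSum (n i : ℕ) : ℝ :=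
  ∑ τ ∈ Finset.Icc 2 (i - 1), 1 / ((n : ℝ) - (τ : ℝ) - 1)

/-- The sum of `1 / (τ - 1)` over `k ≤ τ ≤ n - 2`. -/
noncomputable def upperSum (n k : ℕ) : ℝ :=
  ∑ τ ∈ Finset.Icc k (n - 2), 1 / ((τ : ℝ) - 1)

theorem acoef_eq (n i k : ℕ) :
    acoef n i k = 2 * (1 - 1 / (n : ℝ)) * (lowerSum n i + upperSum n k) + (6 / (n : ℝ) - 2) := by
  simp only [acoef, lowerSum, upperSum, mul_add, Finset.mul_sum, mul_one_div]
  ring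

theorem lowerSum_eq_zero {n i : ℕ} (hi : i ≤ 2) : lowerSum n i = 0 := by
  rw [lowerSum, Finset.Icc_eq_empty (by lia), Finset.sum_empty]

theorem upperSum_eq_zero {n k : ℕ} (hn : 2 ≤ n) (hk : n ≤ k + 1) : upperSum n k = 0 := by
  rw [upperSum, Finset.Icc_eq_empty (by lia), Finset.sum_empty]

theorem lowerSum_succ {n i : ℕ} (hi : 2 ≤ i) :
    lowerSum n (i + 1) = lowerSum n i + 1 / ((n : ℝ) - i - 1) := by
  obtain ⟨m, rfl⟩ : ∃ m, i = m + 1 := ⟨i - 1, by lia⟩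
  simp only [lowerSum, Nat.add_sub_cancel]
  rw [Finset.sum_Icc_succ_top hi]

theorem upperSum_eq_add {n k : ℕ} (hk : k + 2 ≤ n) :
    upperSum n k = 1 / ((k : ℝ) - 1) + upperSum n (k + 1) := by
  rw [upperSum, upperSum, ← Finset.add_sum_Ioc_eq_sum_Icc (by lia),
    ← Finset.Icc_add_one_left_eq_Ioc]

theorem sum_lowerSum_add {n i : ℕ} (hi : 2 ≤ i) (hin : i < n) :
    ∑ j ∈ Finset.Ico 1 i, lowerSum n j + ((n : ℝ) - i) * lowerSum n i = i - 2 := by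
  induction i, hi using Nat.le_induction with
  | base => simp [lowerSum_eq_zero]
  | succ i hi ih =>
    have h := ih (by lia)
    have hne : (n : ℝ) - i - 1 ≠ 0 := by
      have : (i : ℝ) + 1 < n := by exact_mod_cast hin
      linarith
    have hmul : ((n : ℝ) - i - 1) * (1 / ((n : ℝ) - i - 1)) = 1 := mul_one_div_cancel hne
    rw [Finset.sum_Ico_succ_top (by lia), lowerSum_succ hi]
    push_cast
    linear_combination h + hmul

theorem sum_Ioc_eq_add {n i : ℕ} (f : ℕ → ℝ) (hin : i < n) :
    ∑ j ∈ Finset.Ioc i n, f j = f (i + 1) + ∑ j ∈ Finset.Ioc (i + 1) n, f j := by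
  rw [Finset.add_sum_Ioc_eq_sum_Icc (by lia), Finset.Icc_add_one_left_eq_Ioc]

theorem sum_upperSum_add {n i : ℕ} (hi : 2 ≤ i) (hin : i < n) :
    ∑ j ∈ Finset.Ioc i n, upperSum n j + ((i : ℝ) - 1) * upperSum n i = n - 1 - i := by
  obtain ⟨d, rfl⟩ : ∃ d, n = i + d + 1 := ⟨n - i - 1, by lia⟩
  generalize hn : i + d + 1 = n at *
  induction d generalizing i with
  | zero =>
    subst hn
    rw [sum_Ioc_eq_add _ hin, upperSum_eq_zero (by lia) (by lia),
      upperSum_eq_zero (by lia) (by lia)]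
    simp
  | succ d ih =>
    have h := ih (i := i + 1) (by lia) (by lia) (by lia)
    have hne : (i : ℝ) - 1 ≠ 0 := by
      have : (2 : ℝ) ≤ i := by exact_mod_cast hi
      linarith
    have hmul : ((i : ℝ) - 1) * (1 / ((i : ℝ) - 1)) = 1 := mul_one_div_cancel hne
    rw [sum_Ioc_eq_add _ hin, upperSum_eq_add (k := i) (by lia)]
    push_cast at h
    linear_combination h + hmul

theorem sum_lowerSum_add_sum_upperSum {n i : ℕ} (hn : 4 ≤ n) (hi : 1 ≤ i) (hin : i ≤ n) :
    (∑ j ∈ Finset.Ico 1 i, lowerSum n j + ((n : ℝ) - i) * lowerSum n i) +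
      (∑ j ∈ Finset.Ioc i n, upperSum n j + ((i : ℝ) - 1) * upperSum n i) = n - 3 := by
  rcases hi.eq_or_lt with rfl | hi
  · have h := sum_upperSum_add (n := n) le_rfl (by lia)
    rw [sum_Ioc_eq_add _ (by lia), lowerSum_eq_zero (by lia)]
    push_cast at h ⊢
    simp only [Finset.Ico_self, Finset.sum_empty]
    linear_combination h
  rcases hin.eq_or_lt with rfl | hin
  · obtain ⟨m, rfl⟩ : ∃ m, i = m + 1 := ⟨i - 1, by lia⟩
    have h := sum_lowerSum_add (n := m + 1) (i := m) (by lia) (by lia)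
    rw [Finset.sum_Ico_succ_top (by lia), upperSum_eq_zero (by lia) (by lia)]
    push_cast at h ⊢
    simp only [Finset.Ioc_self, Finset.sum_empty]
    linear_combination h
  · rw [sum_lowerSum_add hi hin, sum_upperSum_add hi hin]
    ring

theorem sum_asym_eq {n i : ℕ} (hi : 1 ≤ i) (hin : i ≤ n) :
    ∑ j ∈ Finset.Icc 1 n, asym n i j =
      ∑ j ∈ Finset.Ico 1 i, acoef n j i + ∑ j ∈ Finset.Ioc i n, acoef n i j := by
  have hlow : ∑ j ∈ Finset.Ico 1 i, asym n i j = ∑ j ∈ Finset.Ico 1 i, acoef n j i :=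
    Finset.sum_congr rfl fun j hj => by
      have := (Finset.mem_Ico.mp hj).2
      rw [asym, if_neg (by lia), if_neg (by lia)]
  have hupp : ∑ j ∈ Finset.Ioc i n, asym n i j = ∑ j ∈ Finset.Ioc i n, acoef n i j :=
    Finset.sum_congr rfl fun j hj => by
      have := (Finset.mem_Ioc.mp hj).1
      rw [asym, if_neg (by lia), if_pos (by lia)]
  have hdiag : asym n i i = 0 := if_pos rfl
  have hIcc : Finset.Icc 1 n = Finset.Ico 1 (n + 1) :=
    (Finset.Ico_add_one_right_eq_Icc 1 n).symm
  rw [hIcc, ← Finset.sum_Ico_consecutive _ hi (by lia : i ≤ n + 1), hlow, ← hupp,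
    Finset.sum_eq_sum_Ico_succ_bot (by lia : i < n + 1), hdiag, zero_add,
    Finset.Ico_add_one_add_one_eq_Ioc]

/-- every row sum of the symmetrically extended coefficients vanishes:
`Σ_{j=1}^{n} a_{i,j} = 0` for each `i ∈ {1,…,n}`. -/
theorem stmt2 (n : ℕ) (hn : 4 ≤ n) (i : ℕ) (hi : i ∈ Finset.Icc 1 n) :
    ∑ j ∈ Finset.Icc 1 n, asym n i j = 0 := by
  obtain ⟨hi, hin⟩ := Finset.mem_Icc.mp hi
  have h := sum_lowerSum_add_sum_upperSum hn hi hin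
  have hn0 : (n : ℝ) ≠ 0 := by positivity
  rw [sum_asym_eq hi hin]
  simp only [acoef_eq, Finset.sum_add_distrib, ← Finset.mul_sum, Finset.sum_const, Nat.card_Ico,
    Nat.card_Ioc, nsmul_eq_mul, Nat.cast_sub hi, Nat.cast_sub hin, Nat.cast_one]
  have hc : 2 * (1 - 1 / (n : ℝ)) * (n - 3) + (n - 1) * (6 / n - 2) = 0 := by
    field_simp
    ring
  linear_combination 2 * (1 - 1 / (n : ℝ)) * h + hc
end

section
/- With a_{i,k} the coefficients defined below, the normalized sum of squares converges: (1/n²) · Σ_{k=2}^{n} Σ_{i=1}^{k−1} a_{i,k}² → (2π² − 18)/3 as n → ∞. -/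
open Finset

theorem sum_antidiagonal_inv_mul_inv (m : ℕ) :
    ∑ x ∈ antidiagonal m, ((x.1 + 1 : ℚ)⁻¹ * (x.2 + 1 : ℚ)⁻¹) = 2 * harmonic (m + 1) / (m + 2) := by
  have h1 : ∑ x ∈ antidiagonal m, (x.1 + 1 : ℚ)⁻¹ = harmonic (m + 1) := by
    rw [Finset.Nat.sum_antidiagonal_eq_sum_range_succ_mk]
    simp [harmonic]
  have h2 : ∑ x ∈ antidiagonal m, (x.2 + 1 : ℚ)⁻¹ = harmonic (m + 1) := by
    rw [← h1, ← Finset.Nat.sum_antidiagonal_swap]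
    simp
  have : 2 * harmonic (m + 1) / (m + 2) =
      ∑ x ∈ antidiagonal m, ((x.1 + 1 : ℚ)⁻¹ + (x.2 + 1 : ℚ)⁻¹) / (m + 2) := by
    rw [← Finset.sum_div, Finset.sum_add_distrib, h1, h2, two_mul]
  rw [this]
  refine Finset.sum_congr rfl fun x hx => ?_
  have hm : (m : ℚ) = x.1 + x.2 := by rw [← Finset.HasAntidiagonal.mem_antidiagonal.1 hx]; push_cast; ring
  rw [hm]
  field_simp
  ring

theorem sum_antidiagonal_harmonic_div (m : ℕ) :
    ∑ x ∈ antidiagonal m, harmonic x.1 * (x.2 + 1 : ℚ)⁻¹ =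
      harmonic (m + 1) ^ 2 - ∑ r ∈ range (m + 1), ((r + 1 : ℚ) ^ 2)⁻¹ := by
  induction m with
  | zero => simp [harmonic]
  | succ m ih =>
    rw [Finset.Nat.sum_antidiagonal_succ]
    have : ∑ x ∈ antidiagonal m, harmonic (x.1 + 1) * (x.2 + 1 : ℚ)⁻¹ =
        ∑ x ∈ antidiagonal m, harmonic x.1 * (x.2 + 1 : ℚ)⁻¹ +
          ∑ x ∈ antidiagonal m, ((x.1 + 1 : ℚ)⁻¹ * (x.2 + 1 : ℚ)⁻¹) := by
      rw [← Finset.sum_add_distrib]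
      refine Finset.sum_congr rfl fun x _ => ?_
      rw [harmonic_succ]; push_cast; ring
    rw [this, ih, sum_antidiagonal_inv_mul_inv, Finset.sum_range_succ _ (m + 1),
      harmonic_succ (m + 1)]
    simp only [harmonic_zero]
    push_cast
    field_simp
    ring

theorem sum_range_harmonic (m : ℕ) :
    ∑ p ∈ range (m + 1), harmonic p = (m + 1) * harmonic m - m := by
  induction m with
  | zero => simp
  | succ m ih =>
    rw [Finset.sum_range_succ, ih, harmonic_succ]
    push_cast
    field_simp
    ring

theorem sum_antidiagonal_harmonic_mul_harmonic (m : ℕ) :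
    ∑ x ∈ antidiagonal m, harmonic x.1 * harmonic x.2 =
      (m + 1) * (harmonic m ^ 2 - ∑ r ∈ range m, ((r + 1 : ℚ) ^ 2)⁻¹) - 2 * m * harmonic m
        + 2 * m := by
  induction m with
  | zero => simp
  | succ m ih =>
    rw [Finset.Nat.sum_antidiagonal_succ']
    have : ∑ x ∈ antidiagonal m, harmonic x.1 * harmonic (x.2 + 1) =
        ∑ x ∈ antidiagonal m, harmonic x.1 * harmonic x.2 +
          ∑ x ∈ antidiagonal m, harmonic x.1 * (x.2 + 1 : ℚ)⁻¹ := by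
      rw [← Finset.sum_add_distrib]
      refine Finset.sum_congr rfl fun x _ => ?_
      rw [harmonic_succ]; push_cast; ring
    rw [this, ih, sum_antidiagonal_harmonic_div, Finset.sum_range_succ _ m, harmonic_succ m]
    simp only [harmonic_zero]
    push_cast
    field_simp
    ring

theorem sum_antidiagonal_harmonic_sub_mul (m : ℕ) :
    ∑ x ∈ antidiagonal m, (harmonic m - harmonic x.1) * (harmonic m - harmonic x.2) =
      2 * m - (m + 1) * ∑ r ∈ range m, ((r + 1 : ℚ) ^ 2)⁻¹ := by
  have h1 : ∑ x ∈ antidiagonal m, harmonic x.1 = (m + 1) * harmonic m - m := by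
    rw [Finset.Nat.sum_antidiagonal_eq_sum_range_succ_mk]
    exact sum_range_harmonic m
  have h2 : ∑ x ∈ antidiagonal m, harmonic x.2 = (m + 1) * harmonic m - m := by
    rw [← h1, ← Finset.Nat.sum_antidiagonal_swap]
    simp
  have h : ∀ x : ℕ × ℕ, (harmonic m - harmonic x.1) * (harmonic m - harmonic x.2) =
      harmonic m ^ 2 - harmonic m * harmonic x.1 - harmonic m * harmonic x.2
        + harmonic x.1 * harmonic x.2 := fun x => by ring
  simp only [h, Finset.sum_add_distrib, Finset.sum_sub_distrib, ← Finset.mul_sum, h1, h2,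
    sum_antidiagonal_harmonic_mul_harmonic, Finset.sum_const, Finset.Nat.card_antidiagonal,
    nsmul_eq_mul]
  push_cast
  ring

theorem sum_range_harmonic_sub (m : ℕ) :
    ∑ p ∈ range (m + 1), (harmonic m - harmonic p) = m := by
  rw [Finset.sum_sub_distrib, sum_range_harmonic]
  simp

theorem sum_range_cast_add_one (m : ℕ) :
    ∑ p ∈ range (m + 1), ((p : ℚ) + 1) = (m + 1) * (m + 2) / 2 := by
  induction m with
  | zero => simp
  | succ m ih => rw [Finset.sum_range_succ, ih]; push_cast; ring

theorem sum_range_mul_harmonic_sub (m : ℕ) :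
    ∑ p ∈ range (m + 1), (p + 1) * (harmonic m - harmonic p) = (m * (m + 3) / 4 : ℚ) := by
  induction m with
  | zero => simp
  | succ m ih =>
    have h : ∀ p : ℕ, ((p : ℚ) + 1) * (harmonic (m + 1) - harmonic p) =
        (p + 1) * (harmonic m - harmonic p) + (p + 1) * (m + 1 : ℚ)⁻¹ := fun p => by
      rw [harmonic_succ]; push_cast; ring
    rw [Finset.sum_range_succ, sub_self, mul_zero, add_zero]
    rw [Finset.sum_congr rfl fun p _ => h p, Finset.sum_add_distrib, ← Finset.sum_mul,
      sum_range_cast_add_one, ih]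
    push_cast
    field_simp
    ring

theorem sum_range_mul_harmonic_sub_sq (m : ℕ) :
    ∑ p ∈ range (m + 1), (p + 1) * (harmonic m - harmonic p) ^ 2 =
      (m * (m + 5) / 4 - harmonic m / 2 : ℚ) := by
  induction m with
  | zero => simp
  | succ m ih =>
    have h : ∀ p : ℕ, ((p : ℚ) + 1) * (harmonic (m + 1) - harmonic p) ^ 2 =
        (p + 1) * (harmonic m - harmonic p) ^ 2
          + 2 * (m + 1 : ℚ)⁻¹ * ((p + 1) * (harmonic m - harmonic p))
          + (p + 1) * (m + 1 : ℚ)⁻¹ ^ 2 := fun p => by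
      rw [harmonic_succ]; push_cast; ring
    rw [Finset.sum_range_succ, sub_self, zero_pow two_ne_zero, mul_zero, add_zero]
    rw [Finset.sum_congr rfl fun p _ => h p, Finset.sum_add_distrib, Finset.sum_add_distrib,
      ← Finset.sum_mul, ← Finset.mul_sum, sum_range_cast_add_one, ih,
      sum_range_mul_harmonic_sub, harmonic_succ m]
    push_cast
    field_simp
    ring

theorem sum_range_sum_range_reflect (g : ℕ → ℚ) (m : ℕ) :
    ∑ q ∈ range (m + 1), ∑ j ∈ range (q + 1), g (m - j) =
      ∑ p ∈ range (m + 1), (p + 1 : ℚ) * g p := by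
  rw [Finset.sum_comm' (t' := range (m + 1)) (s' := fun j => Finset.Ico j (m + 1))
    (fun q j => by simp only [Finset.mem_range, Finset.mem_Ico]; omega)]
  rw [← Finset.sum_range_reflect]
  refine Finset.sum_congr rfl fun j hj => ?_
  have hj' : j ≤ m := Nat.lt_succ_iff.1 (Finset.mem_range.1 hj)
  rw [Finset.sum_const, Nat.card_Ico, nsmul_eq_mul, Nat.add_sub_cancel, Nat.sub_sub_self hj',
    show m + 1 - (m - j) = j + 1 by omega]
  push_cast
  ring

theorem sum_range_harmonic_sub_reflect {m q : ℕ} (hq : q ≤ m) :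
    ∑ j ∈ range (q + 1), (harmonic m - harmonic (m - j)) =
      q - (m - q : ℚ) * (harmonic m - harmonic (m - q)) := by
  induction q with
  | zero => simp
  | succ q ih =>
    obtain ⟨r, rfl⟩ := Nat.exists_eq_add_of_le hq
    rw [Finset.sum_range_succ, ih (by omega), show q + 1 + r - q = r + 1 by omega,
      show q + 1 + r - (q + 1) = r by omega, harmonic_succ r]
    push_cast
    field_simp
    ring

theorem sum_range_harmonic_sub_mul_reflect (m : ℕ) :
    ∑ q ∈ range (m + 1), (m - q : ℚ) * ((harmonic m - harmonic (m - q)) * (harmonic m - harmonic q))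
      = m / 2 * (2 * m - (m + 1) * ∑ r ∈ range m, ((r + 1 : ℚ) ^ 2)⁻¹) := by
  have h1 : ∑ x ∈ antidiagonal m,
      (x.2 : ℚ) * ((harmonic m - harmonic x.1) * (harmonic m - harmonic x.2)) =
      ∑ x ∈ antidiagonal m,
        (x.1 : ℚ) * ((harmonic m - harmonic x.1) * (harmonic m - harmonic x.2)) := by
    rw [← Finset.Nat.sum_antidiagonal_swap]
    refine Finset.sum_congr rfl fun x _ => ?_
    simp only [Prod.fst_swap, Prod.snd_swap]
    ring
  have h2 : ∑ x ∈ antidiagonal m,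
      (x.2 : ℚ) * ((harmonic m - harmonic x.1) * (harmonic m - harmonic x.2)) +
      ∑ x ∈ antidiagonal m,
        (x.1 : ℚ) * ((harmonic m - harmonic x.1) * (harmonic m - harmonic x.2)) =
      m * ∑ x ∈ antidiagonal m, (harmonic m - harmonic x.1) * (harmonic m - harmonic x.2) := by
    rw [← Finset.sum_add_distrib, Finset.mul_sum]
    refine Finset.sum_congr rfl fun x hx => ?_
    have hm : (m : ℚ) = x.1 + x.2 := by
      rw [← Finset.HasAntidiagonal.mem_antidiagonal.1 hx]; push_cast; ring
    linear_combination
      -((harmonic m - harmonic x.1) * (harmonic m - harmonic x.2)) * hm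
  rw [sum_antidiagonal_harmonic_sub_mul] at h2
  have h3 : ∑ q ∈ range (m + 1),
      (m - q : ℚ) * ((harmonic m - harmonic (m - q)) * (harmonic m - harmonic q)) =
      ∑ x ∈ antidiagonal m,
        (x.2 : ℚ) * ((harmonic m - harmonic x.1) * (harmonic m - harmonic x.2)) := by
    rw [Finset.Nat.sum_antidiagonal_eq_sum_range_succ_mk]
    refine Finset.sum_congr rfl fun q hq => ?_
    rw [Nat.cast_sub (Nat.lt_succ_iff.1 (Finset.mem_range.1 hq))]
    ring
  rw [h3]
  linarith

theorem sum_sum_harmonic_sub_sq (m : ℕ) :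
    ∑ q ∈ range (m + 1), ∑ j ∈ range (q + 1),
        ((harmonic m - harmonic (m - j)) + (harmonic m - harmonic q) - 1) ^ 2 =
      -(3 / 2) * m ^ 2 + m / 2 + 1 - harmonic m
        + m * (m + 1) * ∑ r ∈ range m, ((r + 1 : ℚ) ^ 2)⁻¹ := by
  have h : ∀ q ∈ range (m + 1), ∑ j ∈ range (q + 1),
        ((harmonic m - harmonic (m - j)) + (harmonic m - harmonic q) - 1) ^ 2 =
      ∑ j ∈ range (q + 1), (fun p => (harmonic m - harmonic p) ^ 2
        - 2 * (harmonic m - harmonic p)) (m - j)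
      + (q + 1) * (harmonic m - harmonic q) ^ 2
      - 2 * (harmonic m - harmonic q)
      - 2 * ((m - q) * ((harmonic m - harmonic (m - q)) * (harmonic m - harmonic q)))
      + (q + 1) := by
    intro q hq
    have e := sum_range_harmonic_sub_reflect (Nat.lt_succ_iff.1 (Finset.mem_range.1 hq))
    have e' : ∀ j : ℕ, ((harmonic m - harmonic (m - j)) + (harmonic m - harmonic q) - 1) ^ 2 =
        ((harmonic m - harmonic (m - j)) ^ 2 - 2 * (harmonic m - harmonic (m - j)))
        + 2 * (harmonic m - harmonic q) * (harmonic m - harmonic (m - j))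
        + ((harmonic m - harmonic q) - 1) ^ 2 := fun j => by ring
    rw [Finset.sum_congr rfl fun j _ => e' j, Finset.sum_add_distrib, Finset.sum_add_distrib,
      ← Finset.mul_sum, e, Finset.sum_const, Finset.card_range, nsmul_eq_mul]
    push_cast
    ring
  rw [Finset.sum_congr rfl h]
  have e' : ∀ p : ℕ, (p + 1 : ℚ) * ((harmonic m - harmonic p) ^ 2 - 2 * (harmonic m - harmonic p))
      = (p + 1) * (harmonic m - harmonic p) ^ 2
        - 2 * ((p + 1) * (harmonic m - harmonic p)) := fun p => by ring
  rw [Finset.sum_add_distrib, Finset.sum_sub_distrib, Finset.sum_sub_distrib,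
    Finset.sum_add_distrib, sum_range_sum_range_reflect
      (fun p => (harmonic m - harmonic p) ^ 2 - 2 * (harmonic m - harmonic p)),
    Finset.sum_congr rfl fun p _ => e' p,
    Finset.sum_sub_distrib, ← Finset.mul_sum, ← Finset.mul_sum, ← Finset.mul_sum,
    sum_range_mul_harmonic_sub, sum_range_mul_harmonic_sub_sq, sum_range_harmonic_sub,
    sum_range_harmonic_sub_mul_reflect, sum_range_cast_add_one]
  ring

theorem sum_Icc_inv_reflect {m j : ℕ} (hj : 1 ≤ j) (hjm : j ≤ m) :
    ∑ τ ∈ Icc 2 j, (m + 1 - τ : ℝ)⁻¹ = harmonic m - harmonic (m - j) - (m : ℝ)⁻¹ := by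
  induction j, hj using Nat.le_induction with
  | base =>
    obtain ⟨r, rfl⟩ := Nat.exists_eq_add_of_le' hjm
    simp [harmonic_succ]
  | succ j hj ih =>
    obtain ⟨r, rfl⟩ := Nat.exists_eq_add_of_le hjm
    rw [Finset.sum_Icc_succ_top (by omega), ih (by omega), show j + 1 + r - j = r + 1 by omega,
      show j + 1 + r - (j + 1) = r by omega, harmonic_succ r]
    push_cast
    ring

theorem sum_Icc_inv {m q : ℕ} (hqm : q + 1 ≤ m) :
    ∑ τ ∈ Icc (q + 2) m, (τ - 1 : ℝ)⁻¹ = harmonic m - harmonic q - (m : ℝ)⁻¹ := by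
  induction m, hqm using Nat.le_induction with
  | base => simp [harmonic_succ]
  | succ m hm ih =>
    rw [Finset.sum_Icc_succ_top (by omega), ih, harmonic_succ m]
    push_cast
    ring

theorem acoef_eq_s3 (m j q : ℕ) :
    acoef (m + 2) (j + 1) (q + 2) = 2 * (1 - 1 / (m + 2 : ℝ)) *
      (∑ τ ∈ Icc 2 j, (m + 1 - τ : ℝ)⁻¹ + ∑ τ ∈ Icc (q + 2) m, (τ - 1 : ℝ)⁻¹)
      + 6 / (m + 2 : ℝ) - 2 := by
  simp only [acoef, Nat.add_sub_cancel, mul_add, Finset.mul_sum]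
  congr 3
  · refine Finset.sum_congr rfl fun τ _ => ?_
    rw [div_eq_mul_inv]
    push_cast
    ring_nf
  · push_cast
    rfl
  · push_cast
    rfl

theorem abs_sq_sub_sq_le {n H x y s t : ℝ} (hH : 1 ≤ H) (hn : 1 ≤ n)
    (hx : x ≤ H) (hy : y ≤ H) (hs : 0 ≤ s) (hsx : s ≤ x)
    (hxs : x ≤ s + n⁻¹) (ht : 0 ≤ t) (hty : t ≤ y) (hyt : y ≤ t + n⁻¹) :
    |(2 * (1 - 1 / (n + 2)) * (s + t) + 6 / (n + 2) - 2) ^ 2 - (2 * (x + y - 1)) ^ 2| ≤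
      252 * (H ^ 2 / n) := by
  have hn0 : 0 < n := by linarith
  set u := 1 / (n + 2) with hu
  set v := n⁻¹ with hv
  have hu0 : 0 < u := by positivity
  have hv0 : 0 < v := by positivity
  have huv : u ≤ v := by
    rw [hu, hv, one_div]; exact inv_anti₀ hn0 (by linarith)
  have hv1 : v ≤ 1 := inv_le_one_of_one_le₀ hn
  have h6 : 6 / (n + 2) = 6 * u := by rw [hu]; ring
  rw [h6, sq_sub_sq, abs_mul, show 252 * (H ^ 2 / n) = (18 * H) * (14 * (H * v)) by
    rw [hv]; field_simp; ring]
  have hus : 0 ≤ u * (s + t) := by positivity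
  have hus' : u * (s + t) ≤ v * (2 * H) := by
    apply mul_le_mul huv <;> linarith
  have hus'' : v * (2 * H) ≤ 2 * H := by nlinarith
  have hvH : v ≤ H * v := by nlinarith
  apply mul_le_mul _ _ (abs_nonneg _) (by positivity)
  · rw [abs_le]; constructor <;> nlinarith
  · rw [abs_le]; constructor <;> nlinarith

theorem one_le_harmonic {m : ℕ} (hm : 1 ≤ m) : (1 : ℝ) ≤ harmonic m := by
  induction m, hm using Nat.le_induction with
  | base => simp [harmonic]
  | succ m hm ih =>
    rw [harmonic_succ]
    push_cast
    have : (0 : ℝ) ≤ (m + 1 : ℝ)⁻¹ := by positivity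
    linarith

theorem harmonic_cast_nonneg (m : ℕ) : (0 : ℝ) ≤ harmonic m := by
  rw [harmonic]; push_cast; positivity

theorem abs_acoef_sq_sub_le {m j q : ℕ} (hm : 1 ≤ m) (hj : j ≤ m) (hq : q ≤ m) :
    |acoef (m + 2) (j + 1) (q + 2) ^ 2 - (2 * (((harmonic m : ℝ) - harmonic (m - j))
      + ((harmonic m : ℝ) - harmonic q) - 1)) ^ 2| ≤ 252 * ((harmonic m : ℝ) ^ 2 / m) := by
  have hm' : (0 : ℝ) ≤ (m : ℝ)⁻¹ := by positivity
  have hnn := harmonic_cast_nonneg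
  have hH := one_le_harmonic hm
  have hs : 0 ≤ ∑ τ ∈ Icc 2 j, (m + 1 - τ : ℝ)⁻¹ := by
    refine Finset.sum_nonneg fun τ hτ => inv_nonneg.2 ?_
    have : (τ : ℝ) ≤ m := by exact_mod_cast (Finset.mem_Icc.1 hτ).2.trans hj
    linarith
  have ht : 0 ≤ ∑ τ ∈ Icc (q + 2) m, (τ - 1 : ℝ)⁻¹ := by
    refine Finset.sum_nonneg fun τ hτ => inv_nonneg.2 ?_
    have : (1 : ℝ) ≤ τ := by exact_mod_cast (by have := (Finset.mem_Icc.1 hτ).1; omega : 1 ≤ τ)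
    linarith
  have hs' : ∑ τ ∈ Icc 2 j, (m + 1 - τ : ℝ)⁻¹ ≤ (harmonic m : ℝ) - harmonic (m - j) ∧
      (harmonic m : ℝ) - harmonic (m - j) ≤ ∑ τ ∈ Icc 2 j, (m + 1 - τ : ℝ)⁻¹ + (m : ℝ)⁻¹ := by
    rcases Nat.eq_zero_or_pos j with rfl | h
    · simp
    · rw [sum_Icc_inv_reflect h hj]
      constructor <;> linarith
  have ht' : ∑ τ ∈ Icc (q + 2) m, (τ - 1 : ℝ)⁻¹ ≤ (harmonic m : ℝ) - harmonic q ∧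
      (harmonic m : ℝ) - harmonic q ≤ ∑ τ ∈ Icc (q + 2) m, (τ - 1 : ℝ)⁻¹ + (m : ℝ)⁻¹ := by
    rcases hq.eq_or_lt with rfl | h
    · simp
    · rw [sum_Icc_inv h]
      constructor <;> linarith
  rw [acoef_eq_s3]
  exact abs_sq_sub_sq_le hH (by exact_mod_cast hm) (by linarith [hnn (m - j)])
    (by linarith [hnn q]) hs hs'.1 hs'.2 ht ht'.1 ht'.2

theorem tendsto_harmonic_sq_div :
    Filter.Tendsto (fun m : ℕ => (harmonic m : ℝ) ^ 2 / m) Filter.atTop (nhds 0) := by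
  have h1 : Filter.Tendsto (fun m : ℕ => 2 * (m : ℝ)⁻¹ + 2 * (Real.log m ^ 2 / m))
      Filter.atTop (nhds (2 * 0 + 2 * 0)) := by
    refine (tendsto_inv_atTop_nhds_zero_nat.const_mul 2).add (Filter.Tendsto.const_mul 2 ?_)
    exact ((Real.isLittleO_pow_log_id_atTop (n := 2)).tendsto_div_nhds_zero).comp
      tendsto_natCast_atTop_atTop
  rw [mul_zero, add_zero] at h1
  refine squeeze_zero (fun m => by positivity) (fun m => ?_) h1
  have hnn := harmonic_cast_nonneg m
  have h := harmonic_le_one_add_log m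
  have : (harmonic m : ℝ) ^ 2 ≤ 2 + 2 * Real.log m ^ 2 := by
    nlinarith [sq_nonneg (1 - Real.log m), pow_le_pow_left₀ hnn h 2]
  calc (harmonic m : ℝ) ^ 2 / m ≤ (2 + 2 * Real.log m ^ 2) / m := by gcongr
    _ = _ := by ring

theorem tendsto_sum_range_inv_sq :
    Filter.Tendsto (fun m : ℕ => ∑ r ∈ range m, ((r + 1 : ℝ) ^ 2)⁻¹) Filter.atTop
      (nhds (Real.pi ^ 2 / 6)) := by
  have h := (hasSum_nat_add_iff' 1).2 hasSum_zeta_two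
  simpa using h.tendsto_sum_nat

theorem sum_acoef_sq_reindex (m : ℕ) :
    ∑ k ∈ Icc 2 (m + 2), ∑ i ∈ Icc 1 (k - 1), acoef (m + 2) i k ^ 2 =
      ∑ q ∈ range (m + 1), ∑ j ∈ range (q + 1), acoef (m + 2) (j + 1) (q + 2) ^ 2 := by
  rw [← Finset.Ico_add_one_right_eq_Icc, Finset.sum_Ico_eq_sum_range,
    show m + 2 + 1 - 2 = m + 1 by omega]
  refine Finset.sum_congr rfl fun q _ => ?_
  rw [← Finset.Ico_add_one_right_eq_Icc, Finset.sum_Ico_eq_sum_range,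
    show 2 + q - 1 + 1 - 1 = q + 1 by omega]
  exact Finset.sum_congr rfl fun j _ => by rw [add_comm 1 j, add_comm 2 q]

theorem abs_sum_acoef_sq_sub_le {m : ℕ} (hm : 1 ≤ m) :
    |1 / ((m + 2 : ℕ) : ℝ) ^ 2 *
        ∑ k ∈ Icc 2 (m + 2), ∑ i ∈ Icc 1 (k - 1), acoef (m + 2) i k ^ 2
      - 4 / ((m + 2 : ℕ) : ℝ) ^ 2 * (-(3 / 2) * m ^ 2 + m / 2 + 1 - harmonic m
        + m * (m + 1) * ∑ r ∈ range m, ((r + 1 : ℝ) ^ 2)⁻¹)| ≤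
      252 * ((harmonic m : ℝ) ^ 2 / m) := by
  have hF : ∑ q ∈ range (m + 1), ∑ j ∈ range (q + 1),
      (((harmonic m : ℝ) - harmonic (m - j)) + ((harmonic m : ℝ) - harmonic q) - 1) ^ 2 =
      -(3 / 2) * m ^ 2 + m / 2 + 1 - harmonic m
        + m * (m + 1) * ∑ r ∈ range m, ((r + 1 : ℝ) ^ 2)⁻¹ := by
    have h := congrArg (Rat.cast : ℚ → ℝ) (sum_sum_harmonic_sub_sq m)
    push_cast at h
    exact h
  have hsum : |∑ q ∈ range (m + 1), ∑ j ∈ range (q + 1),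
      (acoef (m + 2) (j + 1) (q + 2) ^ 2 - (2 * (((harmonic m : ℝ) - harmonic (m - j))
      + ((harmonic m : ℝ) - harmonic q) - 1)) ^ 2)| ≤
      ∑ q ∈ range (m + 1), ∑ j ∈ range (m + 1), 252 * ((harmonic m : ℝ) ^ 2 / m) := by
    refine (Finset.abs_sum_le_sum_abs _ _).trans (Finset.sum_le_sum fun q hq => ?_)
    have hq' := Finset.mem_range.1 hq
    refine (Finset.abs_sum_le_sum_abs _ _).trans ?_
    refine (Finset.sum_le_sum fun j hj => abs_acoef_sq_sub_le hm ?_ (by omega)).trans ?_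
    · have := Finset.mem_range.1 hj
      omega
    · refine Finset.sum_le_sum_of_subset_of_nonneg ?_ fun _ _ _ => by positivity
      exact Finset.range_subset_range.2 (by omega)
  simp only [Finset.sum_const, Finset.card_range, nsmul_eq_mul, Finset.sum_sub_distrib, mul_pow,
    ← Finset.mul_sum] at hsum
  rw [hF, ← sum_acoef_sq_reindex] at hsum
  have hn : (0 : ℝ) < ((m + 2 : ℕ) : ℝ) ^ 2 := by positivity
  set S := ∑ k ∈ Icc 2 (m + 2), ∑ i ∈ Icc 1 (k - 1), acoef (m + 2) i k ^ 2
  set F := -(3 / 2) * (m : ℝ) ^ 2 + m / 2 + 1 - harmonic m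
        + m * (m + 1) * ∑ r ∈ range m, ((r + 1 : ℝ) ^ 2)⁻¹
  rw [show 1 / ((m + 2 : ℕ) : ℝ) ^ 2 * S - 4 / ((m + 2 : ℕ) : ℝ) ^ 2 * F =
    (S - 2 ^ 2 * F) / ((m + 2 : ℕ) : ℝ) ^ 2 by ring, abs_div, abs_of_pos hn, div_le_iff₀ hn]
  refine hsum.trans ?_
  have hE : 0 ≤ 252 * ((harmonic m : ℝ) ^ 2 / m) := by positivity
  push_cast
  nlinarith [mul_nonneg hE (Nat.cast_nonneg (α := ℝ) m)]

theorem tendsto_main_term :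
    Filter.Tendsto (fun m : ℕ => 4 / ((m + 2 : ℕ) : ℝ) ^ 2 *
      (-(3 / 2) * (m : ℝ) ^ 2 + m / 2 + 1 - harmonic m
        + m * (m + 1) * ∑ r ∈ range m, ((r + 1 : ℝ) ^ 2)⁻¹)) Filter.atTop
      (nhds ((2 * Real.pi ^ 2 - 18) / 3)) := by
  have ht : Filter.Tendsto (fun m : ℕ => ((m + 2 : ℕ) : ℝ)⁻¹) Filter.atTop (nhds 0) :=
    (Filter.tendsto_add_atTop_iff_nat (f := fun m : ℕ => (m : ℝ)⁻¹) 2).2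
      tendsto_inv_atTop_nhds_zero_nat
  have hH : Filter.Tendsto (fun m : ℕ => (harmonic m : ℝ) * ((m + 2 : ℕ) : ℝ)⁻¹ ^ 2)
      Filter.atTop (nhds 0) := by
    have h := tendsto_harmonic_sq_div.add tendsto_inv_atTop_nhds_zero_nat
    rw [add_zero] at h
    refine squeeze_zero (fun m => mul_nonneg (harmonic_cast_nonneg m) (by positivity))
      (fun m => ?_) h
    rcases Nat.eq_zero_or_pos m with rfl | hm
    · simp
    have hm' : (1 : ℝ) ≤ m := by exact_mod_cast hm
    have hnn := harmonic_cast_nonneg m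
    have hinv : ((m + 2 : ℕ) : ℝ)⁻¹ ^ 2 ≤ (m : ℝ)⁻¹ := by
      rw [inv_pow]
      refine inv_anti₀ (by linarith) ?_
      push_cast
      nlinarith
    calc (harmonic m : ℝ) * ((m + 2 : ℕ) : ℝ)⁻¹ ^ 2
        ≤ ((harmonic m : ℝ) ^ 2 + 1) * (m : ℝ)⁻¹ := by
          apply mul_le_mul _ hinv (by positivity) (by positivity)
          nlinarith [sq_nonneg ((harmonic m : ℝ) - 1)]
      _ = _ := by ring
  have h := ((((ht.const_mul 2).const_sub 1).pow 2).const_mul (-(3 / 2) : ℝ)).add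
    (((((ht.const_mul 2).const_sub 1).mul ht).div_const 2).add (ht.pow 2)) |>.sub hH |>.add
    ((((ht.const_mul 2).const_sub 1).mul (ht.const_sub 1)).mul tendsto_sum_range_inv_sq)
    |>.const_mul 4
  convert h using 2 with m
  · push_cast
    field_simp
    ring
  · ring

/-- `(1/n²) Σ_{k=2}^{n} Σ_{i=1}^{k−1} a_{i,k}² → (2π² − 18)/3` as `n → ∞`. -/
theorem stmt3 :
    Filter.Tendsto
      (fun n : ℕ => (1 / (n : ℝ) ^ 2) *
        ∑ k ∈ Finset.Icc 2 n, ∑ i ∈ Finset.Icc 1 (k - 1), (acoef n i k) ^ 2)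
      Filter.atTop (nhds ((2 * Real.pi ^ 2 - 18) / 3)) := by
  rw [← Filter.tendsto_add_atTop_iff_nat 2]
  have hzero : Filter.Tendsto (fun m : ℕ => 252 * ((harmonic m : ℝ) ^ 2 / m)) Filter.atTop
      (nhds 0) := by simpa using tendsto_harmonic_sq_div.const_mul 252
  have herr := squeeze_zero_norm' (Filter.eventually_atTop.2 ⟨1, fun m hm => by
    rw [Real.norm_eq_abs]; exact abs_sum_acoef_sq_sub_le hm⟩) hzero
  simpa using herr.add tendsto_main_term
end
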